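/- arXiv:2603.22240 — 6 statements merged into one kernel-verified Lean document; each statement's English description precedes it below -/
import Mathlib

section
/- Let d ≥ 1 be an integer and C a caterpillar whose solution-tight packing contains all vertices of C, and let γ be the essence of C relative to d. Then γ is non-decreasing (x ≤ y implies γ(x) ≤ γ(y)), γ(0) = 0, and γ(d+1) = d+1. -/
namespace CocPaper

open SimpleGraph

variable {V : Type} {W : Type}

/-- `S` is a `d`-coc set of the subgraph of `G` induced on the vertex set `A`:
after deleting `S`, every connected component has at most `d` vertices. -/
def IsCocSetOn (G : SimpleGraph V) (A : Set V) (d : ℕ) (S : Set V) : Prop :=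
  ∀ c : (G.induce (A \ S)).ConnectedComponent, c.supp.ncard ≤ d

/-- The minimum size of a `d`-coc set of the subgraph of `G` induced on `A`. -/
noncomputable def cocOptOn (G : SimpleGraph V) (A : Set V) (d : ℕ) : ℕ :=
  sInf {m : ℕ | ∃ S : Set V, S ⊆ A ∧ IsCocSetOn G A d S ∧ S.ncard = m}

/-- `S` is a minimum `d`-coc set of the subgraph of `G` induced on `A`. -/
def IsMinCocSetOn (G : SimpleGraph V) (A : Set V) (d : ℕ) (S : Set V) : Prop :=
  S ⊆ A ∧ IsCocSetOn G A d S ∧ S.ncard = cocOptOn G A d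

/-- `X` is a `d`-blocking set of `G[A]`: no minimum `d`-coc set contains `X`. -/
def IsBlockingSetOn (G : SimpleGraph V) (A : Set V) (d : ℕ) (X : Set V) : Prop :=
  ∀ S : Set V, IsMinCocSetOn G A d S → ¬ X ⊆ S

/-- A minimal `d`-blocking set: a `d`-blocking set no proper subset of which is one. -/
def IsMinimalBlockingSetOn (G : SimpleGraph V) (A : Set V) (d : ℕ) (X : Set V) : Prop :=
  IsBlockingSetOn G A d X ∧ ∀ Y : Set V, Y ⊂ X → ¬ IsBlockingSetOn G A d Y

/-- `G` is (isomorphic to) a path graph, possibly empty. -/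
def IsPathGraph (G : SimpleGraph V) : Prop :=
  ∃ n : ℕ, Nonempty (G ≃g SimpleGraph.pathGraph n)

/-- A caterpillar: a tree such that deleting all vertices of degree one yields a
(possibly empty) path. -/
def IsCaterpillar (G : SimpleGraph V) : Prop :=
  G.IsTree ∧ IsPathGraph (G.induce {v : V | (G.neighborSet v).ncard ≠ 1})

/-- A caterpillar forest: every connected component is a caterpillar. -/
def IsCaterpillarForest (G : SimpleGraph V) : Prop :=
  ∀ c : G.ConnectedComponent, IsCaterpillar (G.induce c.supp)

/-- `G` is (isomorphic to) a cycle graph. -/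
def IsCycleGraph (G : SimpleGraph V) : Prop :=
  ∃ n : ℕ, 3 ≤ n ∧ Nonempty (G ≃g SimpleGraph.cycleGraph n)

/-- A connected subgraph of `G` which is a caterpillar, equipped with a fixed
nonempty spine listed in left-to-right order: the spine is a path in `G` inside
`verts`, and every vertex of `verts` off the spine has degree one in the subgraph. -/
structure SubCaterpillar (G : SimpleGraph V) where
  verts : Set V
  n : ℕ
  npos : 0 < n
  spine : Fin n → V
  spineMem : ∀ i, spine i ∈ verts
  spineInj : Function.Injective spine
  spineAdj : ∀ (i : ℕ) (h : i + 1 < n),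
    G.Adj (spine ⟨i, Nat.lt_of_succ_lt h⟩) (spine ⟨i + 1, h⟩)
  isTree : (G.induce verts).IsTree
  pendant : ∀ v ∈ verts, v ∉ Set.range spine → {w : V | w ∈ verts ∧ G.Adj v w}.ncard = 1

/-- The spine position of a vertex of the caterpillar: its spine index if it is a
spine vertex, and the spine index of its parent if it is a pendant. -/
noncomputable def SubCaterpillar.pos {G : SimpleGraph V} (C : SubCaterpillar G) (v : V) : ℕ :=
  sInf {i : ℕ | ∃ h : i < C.n,
    C.spine ⟨i, h⟩ = v ∨ (v ∉ Set.range C.spine ∧ G.Adj v (C.spine ⟨i, h⟩))}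

/-- `P` is a solution-tight packing of the spined caterpillar `C` with respect to `d`.
Packed (induced, connected) subgraphs are represented by their vertex sets. -/
def IsSTP (G : SimpleGraph V) (d : ℕ) (C : SubCaterpillar G) (P : Finset (Set V)) : Prop :=
  (∀ A ∈ P, A ⊆ C.verts ∧ d + 1 ≤ A.ncard ∧ (G.induce A).Connected) ∧
  ((↑P : Set (Set V)).Pairwise fun A B => Disjoint A B) ∧
  P.card = cocOptOn G C.verts d ∧
  (∀ A ∈ P, ∀ v ∈ C.verts, v ∉ Set.range C.spine → ∀ w ∈ A, G.Adj v w → v ∈ A) ∧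
  (∃ i : ℕ, i ≤ C.n ∧ ∀ j : Fin C.n, ((j : ℕ) < i ↔ ∃ A ∈ P, C.spine j ∈ A)) ∧
  (∀ A ∈ P, ∀ j : Fin C.n, C.spine j ∈ A →
    (∀ j' : Fin C.n, C.spine j' ∈ A → (j' : ℕ) ≤ (j : ℕ)) →
    IsCocSetOn G A d {C.spine j})

/-- A caterpillar forest on the vertex set `F` inside the ambient graph `G`,
with a fixed spine and spine order for each connected component. -/
structure SpinedCatForest (G : SimpleGraph V) (F : Set V) where
  numComps : ℕ
  comp : Fin numComps → SubCaterpillar G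
  sub : ∀ c, (comp c).verts ⊆ F
  cover : ∀ v ∈ F, ∃ c, v ∈ (comp c).verts
  disj : ∀ c c', c ≠ c' → Disjoint (comp c).verts (comp c').verts
  noCross : ∀ c c', c ≠ c' → ∀ v ∈ (comp c).verts, ∀ w ∈ (comp c').verts, ¬ G.Adj v w

/-- `P` is a solution-tight packing of the caterpillar forest `𝔉`: the union over the
connected components of solution-tight packings of the components. -/
def IsForestSTP (G : SimpleGraph V) (d : ℕ) {F : Set V} (𝔉 : SpinedCatForest G F)
    (P : Finset (Set V)) : Prop :=
  ∃ Q : Fin 𝔉.numComps → Finset (Set V),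
    (∀ c, IsSTP G d (𝔉.comp c) (Q c)) ∧
    (↑P : Set (Set V)) = ⋃ c, (↑(Q c) : Set (Set V))

/-- Attach `x` new pendant vertices to the vertex `v` of `H`. -/
def attachPendants (H : SimpleGraph W) (v : W) (x : ℕ) : SimpleGraph (W ⊕ Fin x) :=
  SimpleGraph.fromRel fun a b =>
    (∃ u u', a = Sum.inl u ∧ b = Sum.inl u' ∧ H.Adj u u') ∨
    (∃ i : Fin x, a = Sum.inl v ∧ b = Sum.inr i)

/-- The number of vertices of the connected component of `v` in the graph obtained
from `G[A]` by deleting `S` (this is `0` when `v ∈ S` or `v ∉ A`). -/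
noncomputable def compSizeOn (G : SimpleGraph V) (A S : Set V) (v : V) : ℕ :=
  {w : V | ∃ (hv : v ∈ A \ S) (hw : w ∈ A \ S),
    (G.induce (A \ S)).Reachable ⟨v, hv⟩ ⟨w, hw⟩}.ncard

/-- The essence of a spined caterpillar `C` relative to `d`. -/
noncomputable def SubCaterpillar.essence {G : SimpleGraph V} (C : SubCaterpillar G)
    (d : ℕ) : ℕ → ℕ := fun x =>
  let Cx : SimpleGraph (↥C.verts ⊕ Fin x) :=
    attachPendants (G.induce C.verts) ⟨C.spine ⟨0, C.npos⟩, C.spineMem ⟨0, C.npos⟩⟩ x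
  let vlast : ↥C.verts ⊕ Fin x :=
    Sum.inl ⟨C.spine ⟨C.n - 1, Nat.sub_lt C.npos Nat.one_pos⟩,
      C.spineMem ⟨C.n - 1, Nat.sub_lt C.npos Nat.one_pos⟩⟩
  if x ≤ d ∧ cocOptOn Cx Set.univ d = cocOptOn G C.verts d then
    sInf {b : ℕ | ∃ Y : Set (↥C.verts ⊕ Fin x),
      IsMinCocSetOn Cx Set.univ d Y ∧ b = compSizeOn Cx Set.univ Y vlast}
  else d + 1

/-- The set of vertices of `A` adjacent (in `G`) to some vertex of `X`. -/
def nbrIn (G : SimpleGraph V) (A X : Set V) : Set V :=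
  {v : V | v ∈ A ∧ ∃ m ∈ X, G.Adj v m}

/-- The chunk `X` imposes a (strictly positive) conflict on the subgraph of `G`
induced on the vertex set `A`. -/
def HasConflict (G : SimpleGraph V) (d : ℕ) (A X : Set V) : Prop :=
  cocOptOn G A d < (nbrIn G A X).ncard + cocOptOn G (A \ nbrIn G A X) d

/-- A chunk: a subset of the modulator `M` of size one or two. -/
def IsChunk (M X : Set V) : Prop := X ⊆ M ∧ 1 ≤ X.ncard ∧ X.ncard ≤ 2

/-- The `i`-th graph (0-based) of the `α`-merged packing of the ordered packing `H`. -/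
def mergedPiece {t : ℕ} (H : Fin t → Set V) (α i : ℕ) : Set V :=
  ⋃ (j : Fin t) (_ : i * α ≤ (j : ℕ) ∧ (j : ℕ) < i * α + α), H j

/-- `H` enumerates a solution-tight packing of `C` in left-to-right spine order. -/
def IsOrderedSTP (G : SimpleGraph V) (d : ℕ) (C : SubCaterpillar G) {t : ℕ}
    (H : Fin t → Set V) : Prop :=
  Function.Injective H ∧
  (∃ P : Finset (Set V), IsSTP G d C P ∧ (↑P : Set (Set V)) = Set.range H) ∧
  ∀ k k' : Fin t, k < k' → ∀ v ∈ H k, ∀ w ∈ H k', C.pos v < C.pos w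

/-- Composition of a list of functions: `compList [g₁, …, gₗ] = g₁ ∘ g₂ ∘ ⋯ ∘ gₗ`. -/
def compList (L : List (ℕ → ℕ)) : ℕ → ℕ := L.foldr (· ∘ ·) id

/-- `inc^d_i`: maps `i` to `i+1` and fixes all other inputs. -/
def incAt (i : ℕ) : ℕ → ℕ := fun x => if x = i then i + 1 else x

/-- `dec^d_i`: maps `i` to `i-1` and fixes all other inputs. -/
def decAt (i : ℕ) : ℕ → ℕ := fun x => if x = i then i - 1 else x

/-- `inc^d`: maps every `x` with `1 ≤ x ≤ d` to `x+1` and fixes all other inputs. -/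
def incUpTo (d : ℕ) : ℕ → ℕ := fun x => if 1 ≤ x ∧ x ≤ d then x + 1 else x

/-- `inc^d_{i,j}`: maps every `x` with `i ≤ x ≤ j` to `j` and fixes all other inputs. -/
def incIJ (i j : ℕ) : ℕ → ℕ := fun x => if i ≤ x ∧ x ≤ j then j else x

/-- `dec^d_{i,j}`: maps every `x` with `i ≤ x ≤ j` to `i` and fixes all other inputs. -/
def decIJ (i j : ℕ) : ℕ → ℕ := fun x => if i ≤ x ∧ x ≤ j then i else x

/-- The basic functions relative to `d`. -/
def IsBasicFun (d : ℕ) (f : ℕ → ℕ) : Prop :=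
  f = id ∨ (∃ i, 1 ≤ i ∧ i ≤ d ∧ f = decAt i) ∨ f = incUpTo d

/-- The advanced functions relative to `d`. -/
def IsAdvancedFun (d : ℕ) (f : ℕ → ℕ) : Prop :=
  (∃ i, 1 ≤ i ∧ i ≤ d ∧ f = incAt i) ∨
  (∃ i j, 1 ≤ i ∧ i < j ∧ j ≤ d + 1 ∧ f = incIJ i j) ∨
  (∃ i j, i < j ∧ j ≤ d ∧ f = decIJ i j)

/-- The number of fixed points of `f` on the domain `{0, …, d+1}`. -/
def fixCount (d : ℕ) (f : ℕ → ℕ) : ℕ :=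
  ((Finset.range (d + 2)).filter fun x => f x = x).card

/-- The disjoint union of `G₁` and `G₂` together with the edge `a b`. -/
def joinGraph {V₁ V₂ : Type} (G₁ : SimpleGraph V₁) (G₂ : SimpleGraph V₂)
    (a : V₁) (b : V₂) : SimpleGraph (V₁ ⊕ V₂) :=
  SimpleGraph.fromRel fun x y =>
    (∃ u w, x = Sum.inl u ∧ y = Sum.inl w ∧ G₁.Adj u w) ∨
    (∃ u w, x = Sum.inr u ∧ y = Sum.inr w ∧ G₂.Adj u w) ∨
    (x = Sum.inl a ∧ y = Sum.inr b)

/-- The component of `v` in `G[A] - S`, as a set of vertices of `G`. -/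
theorem compSizeOn_eq_ncard_supp (G : SimpleGraph V) (A S : Set V) (v : V) (hv : v ∈ A \ S) :
    compSizeOn G A S v =
      ((G.induce (A \ S)).connectedComponentMk ⟨v, hv⟩).supp.ncard := by
  rw [← Set.ncard_image_of_injective _ Subtype.val_injective]
  unfold compSizeOn
  congr 1
  ext w
  constructor
  · rintro ⟨_, hw, h⟩
    exact ⟨⟨w, hw⟩, SimpleGraph.ConnectedComponent.sound h.symm, rfl⟩
  · rintro ⟨⟨w', hw⟩, h, rfl⟩
    exact ⟨hv, hw, (SimpleGraph.ConnectedComponent.exact h).symm⟩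

theorem compSizeOn_eq_zero (G : SimpleGraph V) (A S : Set V) (v : V) (hv : v ∉ A \ S) :
    compSizeOn G A S v = 0 := by
  simp [compSizeOn, hv]

theorem isCocSetOn_iff (G : SimpleGraph V) (A : Set V) (d : ℕ) (S : Set V) :
    IsCocSetOn G A d S ↔ ∀ v, compSizeOn G A S v ≤ d := by
  constructor
  · intro h v
    by_cases hv : v ∈ A \ S
    · rw [compSizeOn_eq_ncard_supp G A S v hv]
      exact h _
    · simp [compSizeOn_eq_zero G A S v hv]
  · intro h c
    induction c using SimpleGraph.ConnectedComponent.ind with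
    | h v =>
      obtain ⟨v, hv⟩ := v
      rw [← compSizeOn_eq_ncard_supp G A S v hv]
      exact h v

theorem exists_isMinCocSetOn (G : SimpleGraph V) (A : Set V) (d : ℕ) :
    ∃ S, IsMinCocSetOn G A d S := by
  have hne : {m : ℕ | ∃ S : Set V, S ⊆ A ∧ IsCocSetOn G A d S ∧ S.ncard = m}.Nonempty := by
    refine ⟨_, A, subset_rfl, ?_, rfl⟩
    rw [isCocSetOn_iff]
    intro v
    simp [compSizeOn_eq_zero]
  exact Nat.sInf_mem hne

theorem cocOptOn_le {G : SimpleGraph V} {A : Set V} {d : ℕ} {S : Set V} (hS : S ⊆ A)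
    (h : IsCocSetOn G A d S) : cocOptOn G A d ≤ S.ncard :=
  Nat.sInf_le ⟨S, hS, h, rfl⟩

section Embedding

variable [Finite W] {G : SimpleGraph V} {G' : SimpleGraph W}

theorem compSizeOn_preimage_le (φ : G ↪g G') (S : Set W) (v : V) :
    compSizeOn G Set.univ (φ ⁻¹' S) v ≤ compSizeOn G' Set.univ S (φ v) := by
  unfold compSizeOn
  refine Set.ncard_le_ncard_of_injOn φ ?_ φ.injective.injOn (Set.toFinite _)
  rintro w ⟨hv, hw, h⟩
  let ψ : G.induce (Set.univ \ φ ⁻¹' S) →g G'.induce (Set.univ \ S) :=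
    ⟨fun u => ⟨φ u.1, Set.mem_univ _, u.2.2⟩, fun {a b} hab => φ.map_rel_iff.2 hab⟩
  exact ⟨⟨Set.mem_univ _, hv.2⟩, ⟨Set.mem_univ _, hw.2⟩, h.map ψ⟩

theorem IsCocSetOn.preimage (φ : G ↪g G') {d : ℕ} {S : Set W} (h : IsCocSetOn G' Set.univ d S) :
    IsCocSetOn G Set.univ d (φ ⁻¹' S) := by
  rw [isCocSetOn_iff] at h ⊢
  exact fun v => (compSizeOn_preimage_le φ S v).trans (h _)

theorem ncard_preimage_embedding_le (φ : G ↪g G') (S : Set W) : (φ ⁻¹' S).ncard ≤ S.ncard :=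
  Set.ncard_le_ncard_of_injOn φ (fun _ h => h) φ.injective.injOn (Set.toFinite _)

theorem cocOptOn_le_of_embedding (φ : G ↪g G') (d : ℕ) :
    cocOptOn G Set.univ d ≤ cocOptOn G' Set.univ d := by
  obtain ⟨S, _, hS, hc⟩ := exists_isMinCocSetOn G' Set.univ d
  rw [← hc]
  exact (cocOptOn_le (Set.subset_univ _) (hS.preimage φ)).trans (ncard_preimage_embedding_le φ S)

end Embedding

theorem attachPendants_adj_inl (G : SimpleGraph W) (v : W) (x : ℕ) (a b : W) :
    (attachPendants G v x).Adj (Sum.inl a) (Sum.inl b) ↔ G.Adj a b := by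
  simp only [attachPendants, SimpleGraph.fromRel_adj]
  constructor
  · rintro ⟨_, (⟨u, u', h1, h2, h⟩ | ⟨i, _, h⟩) | (⟨u, u', h1, h2, h⟩ | ⟨i, _, h⟩)⟩
    · cases h1; cases h2; exact h
    · cases h
    · cases h1; cases h2; exact h.symm
    · cases h
  · intro h
    exact ⟨fun e => h.ne (Sum.inl_injective e), Or.inl (Or.inl ⟨a, b, rfl, rfl, h⟩)⟩

/-- Attaching fewer pendants gives an induced subgraph. -/
def attachPendantsEmbedding (G : SimpleGraph W) (v : W) {x y : ℕ} (h : x ≤ y) :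
    attachPendants G v x ↪g attachPendants G v y where
  toFun := Sum.map id (Fin.castLE h)
  inj' := Function.Injective.sumMap Function.injective_id (Fin.castLE_injective h)
  map_rel_iff' := by
    rintro (a | a) (b | b) <;> simp [attachPendants, SimpleGraph.fromRel_adj]

/-- The original graph is an induced subgraph after attaching pendants. -/
def inlEmbedding (G : SimpleGraph V) {A : Set V} (hA : A = Set.univ) (v : A) (x : ℕ) :
    G ↪g attachPendants (G.induce A) v x where
  toFun u := Sum.inl ⟨u, hA ▸ Set.mem_univ u⟩
  inj' a b h := congrArg Subtype.val (Sum.inl_injective h)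
  map_rel_iff' := by
    intro a b
    exact attachPendants_adj_inl _ _ _ _ _

/-- Attaching no pendants to an induced subgraph gives an induced subgraph. -/
def attachZeroEmbedding (G : SimpleGraph V) (A : Set V) (v : A) :
    attachPendants (G.induce A) v 0 ↪g G where
  toFun := Sum.elim Subtype.val Fin.elim0
  inj' := by
    rintro (a | a) (b | b) h
    · exact congrArg _ (Subtype.ext h)
    · exact b.elim0
    · exact a.elim0
    · exact a.elim0
  map_rel_iff' := by
    rintro (a | a) (b | b)
    · exact (attachPendants_adj_inl (G.induce A) v 0 a b).symm
    · exact b.elim0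
    · exact a.elim0
    · exact a.elim0

/-- Consecutive adjacencies along a sequence give reachability of its ends. -/
theorem reachable_of_consecutive_adj {G : SimpleGraph V} {n : ℕ} (s : Fin n → V) (i j : Fin n)
    (hij : i ≤ j)
    (h : ∀ (m : ℕ) (hm : m + 1 < n), i.1 ≤ m → m < j.1 →
      G.Adj (s ⟨m, Nat.lt_of_succ_lt hm⟩) (s ⟨m + 1, hm⟩)) :
    G.Reachable (s i) (s j) := by
  obtain ⟨j, hj⟩ := j
  have hij' : i.1 ≤ j := hij
  clear hij
  induction j, hij' using Nat.le_induction with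
  | base => exact SimpleGraph.Reachable.refl _
  | succ k hk ih =>
    exact (ih (Nat.lt_of_succ_lt hj) fun m hm h1 h2 => h m hm h1 (Nat.lt_succ_of_lt h2)).trans
      (h k hj hk (Nat.lt_succ_self k)).reachable

namespace SubCaterpillar

variable {G : SimpleGraph V} (C : SubCaterpillar G)

theorem isTree_of_verts_eq_univ (h : C.verts = Set.univ) : G.IsTree := by
  have ht := C.isTree
  rw [h] at ht
  exact (SimpleGraph.induceUnivIso G).isTree_iff.1 ht

/-- In a tree, adjacent spine vertices are consecutive on the spine. -/
theorem eq_succ_of_spine_adj (hG : G.IsAcyclic) {i j : Fin C.n} (hij : i < j)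
    (h : G.Adj (C.spine i) (C.spine j)) : j.1 = i.1 + 1 := by
  by_contra hne
  have hlt : i.1 < j.1 := hij
  have hb := SimpleGraph.isAcyclic_iff_forall_adj_isBridge.1 hG h
  rw [SimpleGraph.isBridge_iff] at hb
  refine hb ?_
  refine reachable_of_consecutive_adj C.spine i j hij.le fun m hm h1 h2 => ?_
  rw [SimpleGraph.deleteEdges_adj]
  refine ⟨C.spineAdj m hm, ?_⟩
  simp only [Set.mem_singleton_iff, Sym2.eq_iff, C.spineInj.eq_iff, Fin.ext_iff]
  omega

/-- In a tree, a connected vertex set meets the spine in an interval. -/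
theorem spine_succ_mem (hG : G.IsAcyclic) {A : Set V} (hA : (G.induce A).Connected)
    {i k : Fin C.n} (hik : i < k) (hi : C.spine i ∈ A) (hk : C.spine k ∈ A)
    (hn : i.1 + 1 < C.n) : C.spine ⟨i.1 + 1, hn⟩ ∈ A := by
  by_contra hnot
  have hlt : i.1 < k.1 := hik
  have hb := SimpleGraph.isAcyclic_iff_forall_adj_isBridge.1 hG (C.spineAdj i.1 hn)
  rw [SimpleGraph.isBridge_iff] at hb
  refine hb ?_
  let G' := G.deleteEdges {s(C.spine ⟨i.1, Nat.lt_of_succ_lt hn⟩, C.spine ⟨i.1 + 1, hn⟩)}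
  let ψ : G.induce A →g G' :=
    ⟨Subtype.val, fun {a b} hab => by
      rw [SimpleGraph.deleteEdges_adj]
      refine ⟨hab, ?_⟩
      rintro hmem
      rcases Sym2.eq_iff.1 (Set.mem_singleton_iff.1 hmem) with ⟨_, h⟩ | ⟨h, _⟩
      · exact hnot (h ▸ b.2)
      · exact hnot (h ▸ a.2)⟩
  have h1 : G'.Reachable (C.spine i) (C.spine k) :=
    (hA.preconnected ⟨_, hi⟩ ⟨_, hk⟩).map ψ
  have h2 : G'.Reachable (C.spine ⟨i.1 + 1, hn⟩) (C.spine k) := by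
    refine reachable_of_consecutive_adj C.spine ⟨i.1 + 1, hn⟩ k hlt fun m hm h1 h2 => ?_
    rw [SimpleGraph.deleteEdges_adj]
    refine ⟨C.spineAdj m hm, ?_⟩
    simp only [Set.mem_singleton_iff, Sym2.eq_iff, C.spineInj.eq_iff, Fin.ext_iff]
    simp only at h1
    omega
  exact h1.trans h2.symm

/-- A connected vertex set with at least two vertices meets the spine. -/
theorem exists_spine_mem [Finite V] (h : C.verts = Set.univ) {A : Set V}
    (hA : (G.induce A).Connected) (hcard : 2 ≤ A.ncard) : ∃ j, C.spine j ∈ A := by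
  by_contra! hno
  have hG := C.isTree_of_verts_eq_univ h
  have hnt : Nontrivial A := Set.nontrivial_coe_sort.2 (Set.one_lt_ncard_iff_nontrivial.1 hcard)
  have hclosed : ∀ v ∈ A, ∀ w, G.Adj v w → w ∈ A := by
    intro v hv w hw
    obtain ⟨u, hu⟩ := hA.preconnected.exists_adj_of_nontrivial ⟨v, hv⟩
    have hp := C.pendant v (h ▸ Set.mem_univ v) (by rintro ⟨j, rfl⟩; exact hno j hv)
    obtain ⟨z, hz⟩ := Set.ncard_eq_one.1 hp
    have h1 : w ∈ ({z} : Set V) := hz ▸ ⟨h ▸ Set.mem_univ w, hw⟩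
    have h2 : u.1 ∈ ({z} : Set V) := hz ▸ ⟨h ▸ Set.mem_univ u.1, hu⟩
    rw [Set.mem_singleton_iff] at h1 h2
    rw [h1, ← h2]
    exact u.2
  obtain ⟨⟨v, hv⟩⟩ := hA.nonempty
  obtain ⟨p⟩ := hG.connected.preconnected v (C.spine ⟨0, C.npos⟩)
  have hwalk : ∀ {a b : V}, G.Walk a b → a ∈ A → b ∈ A := by
    intro a b p
    induction p with
    | nil => exact id
    | cons hadj _ ih => exact fun ha => ih (hclosed _ ha _ hadj)
  exact hno _ (hwalk p hv)

/-- `C.spine j` is the rightmost spine vertex of `A`. -/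
def IsRightmost (A : Set V) (j : Fin C.n) : Prop :=
  C.spine j ∈ A ∧ ∀ j', C.spine j' ∈ A → j' ≤ j

theorem exists_isRightmost {A : Set V} (h : ∃ j, C.spine j ∈ A) : ∃ j, C.IsRightmost A j := by
  obtain ⟨j, hj, hmax⟩ := Set.exists_max_image {j | C.spine j ∈ A} id (Set.toFinite _) h
  exact ⟨j, hj, hmax⟩

/-- The rightmost spine vertices of the members of a packing. -/
def rightmostSet (Q : Finset (Set V)) : Set V :=
  {t | ∃ A ∈ Q, ∃ j, C.IsRightmost A j ∧ C.spine j = t}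

theorem ncard_rightmostSet_le (Q : Finset (Set V)) : (C.rightmostSet Q).ncard ≤ Q.card := by
  rw [← Set.ncard_coe_finset Q]
  choose! f hf using fun t (ht : t ∈ C.rightmostSet Q) => ht
  refine Set.ncard_le_ncard_of_injOn f (fun t ht => (hf t ht).1) ?_ (Set.toFinite _)
  intro t ht u hu htu
  obtain ⟨_, j, hj, rfl⟩ := hf t ht
  obtain ⟨_, k, hk, rfl⟩ := hf u hu
  rw [htu] at hj
  exact congrArg _ (le_antisymm (hk.2 _ hj.1) (hj.2 _ hk.1))

/-- The rightmost spine vertices of a solution-tight packing covering the caterpillar form a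
`d`-coc set. -/
theorem isCocSetOn_rightmostSet [Finite V] {d : ℕ} (hd : 1 ≤ d) (h : C.verts = Set.univ)
    {Q : Finset (Set V)} (hQ : IsSTP G d C Q) (hcov : ∀ v, ∃ A ∈ Q, v ∈ A) :
    IsCocSetOn G Set.univ d (C.rightmostSet Q) := by
  obtain ⟨hsub, hdisj, -, hpend, -, hright⟩ := hQ
  have hG := (C.isTree_of_verts_eq_univ h).isAcyclic
  have huniq : ∀ A ∈ Q, ∀ B ∈ Q, ∀ v, v ∈ A → v ∈ B → A = B := by
    intro A hA B hB v hvA hvB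
    by_contra hne
    exact Set.disjoint_left.1 (hdisj hA hB hne) hvA hvB
  have hlast : ∀ A ∈ Q, ∀ i j : Fin C.n, i < j → G.Adj (C.spine i) (C.spine j) →
      C.spine i ∈ A → C.spine j ∉ A → C.spine i ∈ C.rightmostSet Q := by
    intro A hA i j hij hadj hi hj
    refine ⟨A, hA, i, ⟨hi, fun k hk => ?_⟩, rfl⟩
    by_contra hlt
    have hji := C.eq_succ_of_spine_adj hG hij hadj
    have hmem := C.spine_succ_mem hG (hsub A hA).2.2 (not_le.1 hlt) hi hk (hji ▸ j.2)
    exact hj ((Fin.ext hji : j = ⟨i.1 + 1, hji ▸ j.2⟩) ▸ hmem)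
  have hclosed : ∀ A ∈ Q, ∀ v ∈ A, ∀ w, G.Adj v w → v ∉ C.rightmostSet Q →
      w ∉ C.rightmostSet Q → w ∈ A := by
    intro A hA v hv w hadj hvT hwT
    by_contra hwA
    obtain ⟨B, hB, hwB⟩ := hcov w
    have hvB : v ∉ B := fun hvB => hwA (huniq A hA B hB v hv hvB ▸ hwB)
    by_cases hw : w ∈ Set.range C.spine
    · by_cases hv' : v ∈ Set.range C.spine
      · obtain ⟨i, rfl⟩ := hv'
        obtain ⟨j, rfl⟩ := hw
        rcases lt_trichotomy i j with hij | hij | hij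
        · exact hvT (hlast A hA i j hij hadj hv hwA)
        · exact hwA (hij ▸ hv)
        · exact hwT (hlast B hB j i hij hadj.symm hwB hvB)
      · exact hvB (hpend B hB v (h ▸ Set.mem_univ v) hv' w hwB hadj)
    · exact hwA (hpend A hA w (h ▸ Set.mem_univ w) hw v hv hadj.symm)
  rw [isCocSetOn_iff]
  intro v
  by_cases hvT : v ∈ Set.univ \ C.rightmostSet Q
  swap
  · simp [compSizeOn_eq_zero _ _ _ _ hvT]
  obtain ⟨A, hA, hvA⟩ := hcov v
  obtain ⟨j, hj⟩ := C.exists_isRightmost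
    (C.exists_spine_mem h (hsub A hA).2.2 (by have := (hsub A hA).2.1; omega))
  have hjT : C.spine j ∈ C.rightmostSet Q := ⟨A, hA, j, hj, rfl⟩
  refine le_trans ?_ ((isCocSetOn_iff _ _ _ _).1 (hright A hA j hj.1 hj.2) v)
  unfold compSizeOn
  refine Set.ncard_le_ncard ?_ (Set.toFinite _)
  rintro w ⟨hv, hw, ⟨p⟩⟩
  have hdiff : ∀ u ∈ A, u ∉ C.rightmostSet Q → u ∈ A \ {C.spine j} := by
    intro u hu huT
    exact ⟨hu, fun e => huT (Set.mem_singleton_iff.1 e ▸ hjT)⟩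
  have hwalk : ∀ {a b : ↥(Set.univ \ C.rightmostSet Q)},
      (G.induce (Set.univ \ C.rightmostSet Q)).Walk a b → ∀ ha : a.1 ∈ A,
      ∃ hb : b.1 ∈ A, (G.induce (A \ {C.spine j})).Reachable
        ⟨a.1, hdiff _ ha a.2.2⟩ ⟨b.1, hdiff _ hb b.2.2⟩ := by
    intro a b p
    induction p with
    | nil => exact fun ha => ⟨ha, SimpleGraph.Reachable.refl _⟩
    | @cons a c b hadj _ ih =>
      intro ha
      have hc := hclosed A hA a.1 ha c.1 hadj a.2.2 c.2.2
      obtain ⟨hb, hr⟩ := ih hc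
      refine ⟨hb, SimpleGraph.Reachable.trans (SimpleGraph.Adj.reachable ?_) hr⟩
      exact hadj
  obtain ⟨hb, hr⟩ := hwalk p hvA
  exact ⟨hdiff _ hvA hv.2, hdiff _ hb hw.2, hr⟩

theorem spine_last_mem_rightmostSet {Q : Finset (Set V)} (hcov : ∀ v, ∃ A ∈ Q, v ∈ A) :
    C.spine ⟨C.n - 1, Nat.sub_lt C.npos Nat.one_pos⟩ ∈ C.rightmostSet Q := by
  obtain ⟨A, hA, hmem⟩ := hcov (C.spine ⟨C.n - 1, Nat.sub_lt C.npos Nat.one_pos⟩)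
  exact ⟨A, hA, _, ⟨hmem, fun j _ => Nat.le_sub_one_of_lt j.2⟩, rfl⟩

theorem essence_eq_of_lt {d x : ℕ} (h : d < x) : C.essence d x = d + 1 :=
  if_neg fun hx => absurd hx.1 (not_le.2 h)

theorem essence_le (d x : ℕ) : C.essence d x ≤ d + 1 := by
  unfold essence
  simp only
  split_ifs with hx
  · obtain ⟨Y, hY⟩ := exists_isMinCocSetOn (attachPendants (G.induce C.verts)
      ⟨C.spine ⟨0, C.npos⟩, C.spineMem ⟨0, C.npos⟩⟩ x) Set.univ d
    refine le_trans (Nat.sInf_le ⟨Y, hY, rfl⟩) ?_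
    exact ((isCocSetOn_iff _ _ _ _).1 hY.2.1 _).trans (Nat.le_succ d)
  · exact le_rfl

theorem essence_mono [Finite V] (h : C.verts = Set.univ) (d : ℕ) : Monotone (C.essence d) := by
  intro x y hxy
  have hopt : cocOptOn G C.verts d = cocOptOn G Set.univ d := by rw [h]
  by_cases hy : y ≤ d ∧ cocOptOn (attachPendants (G.induce C.verts)
      ⟨C.spine ⟨0, C.npos⟩, C.spineMem ⟨0, C.npos⟩⟩ y) Set.univ d = cocOptOn G C.verts d
  swap
  · exact (C.essence_le d x).trans (if_neg hy).ge
  let φ := attachPendantsEmbedding (G.induce C.verts)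
    ⟨C.spine ⟨0, C.npos⟩, C.spineMem ⟨0, C.npos⟩⟩ hxy
  have h1 := cocOptOn_le_of_embedding φ d
  have h2 := cocOptOn_le_of_embedding
    (inlEmbedding G h ⟨C.spine ⟨0, C.npos⟩, C.spineMem ⟨0, C.npos⟩⟩ x) d
  have hx : x ≤ d ∧ cocOptOn (attachPendants (G.induce C.verts)
      ⟨C.spine ⟨0, C.npos⟩, C.spineMem ⟨0, C.npos⟩⟩ x) Set.univ d = cocOptOn G C.verts d :=
    ⟨hxy.trans hy.1, by omega⟩
  unfold essence
  simp only
  rw [if_pos hx, if_pos hy]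
  obtain ⟨Y₀, hY₀⟩ := exists_isMinCocSetOn (attachPendants (G.induce C.verts)
      ⟨C.spine ⟨0, C.npos⟩, C.spineMem ⟨0, C.npos⟩⟩ y) Set.univ d
  refine le_csInf ⟨_, Y₀, hY₀, rfl⟩ ?_
  rintro _ ⟨Y, hY, rfl⟩
  refine le_trans (Nat.sInf_le ⟨φ ⁻¹' Y, ⟨Set.subset_univ _, hY.2.1.preimage φ, ?_⟩, rfl⟩)
    (compSizeOn_preimage_le φ Y _)
  have h3 := ncard_preimage_embedding_le φ Y
  have h4 := cocOptOn_le (Set.subset_univ _) (hY.2.1.preimage φ)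
  have h5 := hY.2.2
  omega

theorem essence_zero [Finite V] {d : ℕ} (hd : 1 ≤ d) (h : C.verts = Set.univ)
    {Q : Finset (Set V)} (hQ : IsSTP G d C Q) (hcov : ∀ v, ∃ A ∈ Q, v ∈ A) :
    C.essence d 0 = 0 := by
  have hopt : cocOptOn G C.verts d = cocOptOn G Set.univ d := by rw [h]
  let φ := attachZeroEmbedding G C.verts ⟨C.spine ⟨0, C.npos⟩, C.spineMem ⟨0, C.npos⟩⟩
  have h1 := cocOptOn_le_of_embedding φ d
  have h2 := cocOptOn_le_of_embedding
    (inlEmbedding G h ⟨C.spine ⟨0, C.npos⟩, C.spineMem ⟨0, C.npos⟩⟩ 0) d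
  have hcoc := (C.isCocSetOn_rightmostSet hd h hQ hcov).preimage φ
  have hle := cocOptOn_le (Set.subset_univ _) hcoc
  have hcard := ncard_preimage_embedding_le φ (C.rightmostSet Q)
  have hQc := C.ncard_rightmostSet_le Q
  have hQo := hQ.2.2.1
  unfold essence
  simp only
  rw [if_pos ⟨Nat.zero_le d, by omega⟩]
  refine Nat.le_zero.1 (Nat.sInf_le ⟨φ ⁻¹' C.rightmostSet Q,
    ⟨Set.subset_univ _, hcoc, by omega⟩, ?_⟩)
  refine (compSizeOn_eq_zero _ _ _ _ ?_).symm
  exact fun hmem => hmem.2 (C.spine_last_mem_rightmostSet hcov)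

end SubCaterpillar

/-- Let `d ≥ 1` and `C` a caterpillar whose solution-tight packing
contains all vertices of `C`, with essence `γ` relative to `d`. Then `γ` is
non-decreasing, `γ 0 = 0` and `γ (d+1) = d+1`. -/
theorem stmt5 {V : Type} [Fintype V] (H : SimpleGraph V) (d : ℕ) (hd : 1 ≤ d)
    (C : SubCaterpillar H) (hverts : C.verts = Set.univ)
    (hfull : ∃ Q : Finset (Set V), IsSTP H d C Q ∧ ⋃₀ (↑Q : Set (Set V)) = C.verts) :
    (∀ x y : ℕ, x ≤ y → y ≤ d + 1 → C.essence d x ≤ C.essence d y) ∧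
    C.essence d 0 = 0 ∧ C.essence d (d + 1) = d + 1 := by
  obtain ⟨Q, hQ, hcov⟩ := hfull
  have hcov' : ∀ v, ∃ A ∈ Q, v ∈ A := fun v => by
    simpa using (hcov.trans hverts).ge (Set.mem_univ v)
  exact ⟨fun x y hxy _ => C.essence_mono hverts d hxy, C.essence_zero hd hverts hQ hcov',
    C.essence_eq_of_lt (Nat.lt_succ_self d)⟩

end CocPaper
end

section
/- Let d be a positive integer and i ∈ {1,…,d}. Then there exist ℓ ≤ d basic functions g_1,…,g_ℓ relative to d such that inc^d_i = g_1 ∘ g_2 ∘ ⋯ ∘ g_ℓ, where inc^d_i : {0,…,d+1} → {0,…,d+1} maps i to i+1 and fixes all other inputs. -/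
namespace CocPaper

open SimpleGraph

variable {V : Type} {W : Type}

theorem compList_append (L₁ L₂ : List (ℕ → ℕ)) (x : ℕ) :
    compList (L₁ ++ L₂) x = compList L₁ (compList L₂ x) := by
  induction L₁ with
  | nil => rfl
  | cons g L ih => exact congrArg g ih

/-- The list `[dec_{a+n}, …, dec_{a+1}]`. -/
def decChain (a : ℕ) : ℕ → List (ℕ → ℕ)
  | 0 => []
  | n + 1 => decAt (a + n + 1) :: decChain a n

theorem length_decChain (a n : ℕ) : (decChain a n).length = n := by
  induction n with
  | zero => rfl
  | succ n ih => simp [decChain, ih]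

theorem isBasicFun_of_mem_decChain {d a n : ℕ} (h : a + n ≤ d) {g : ℕ → ℕ}
    (hg : g ∈ decChain a n) : IsBasicFun d g := by
  induction n with
  | zero => simp [decChain] at hg
  | succ n ih =>
    rcases List.mem_cons.mp hg with rfl | hg
    · exact Or.inr (Or.inl ⟨a + n + 1, by omega, by omega, rfl⟩)
    · exact ih (by omega) hg

theorem compList_decChain (a n x : ℕ) :
    compList (decChain a n) x = if a < x ∧ x ≤ a + n then x - 1 else x := by
  induction n with
  | zero =>
    rw [if_neg (by omega)]
    rfl
  | succ n ih =>
    change decAt (a + n + 1) (compList (decChain a n) x) = _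
    rw [ih]
    unfold decAt
    split_ifs <;> omega

/-- Let `d ≥ 1` and `i ∈ {1,…,d}`. Then there are `ℓ ≤ d` basic
functions `g₁,…,g_ℓ` relative to `d` with `inc^d_i = g₁ ∘ g₂ ∘ ⋯ ∘ g_ℓ`
(as functions on `{0,…,d+1}`). -/
theorem stmt6 (d : ℕ) (hd : 1 ≤ d) (i : ℕ) (hi1 : 1 ≤ i) (hid : i ≤ d) :
    ∃ L : List (ℕ → ℕ), L.length ≤ d ∧ (∀ g ∈ L, IsBasicFun d g) ∧
      ∀ x ≤ d + 1, incAt i x = compList L x := by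
  refine ⟨decChain 1 (i - 1) ++ incUpTo d :: decChain i (d - i), ?_, ?_, ?_⟩
  · simp only [List.length_append, List.length_cons, length_decChain]
    omega
  · intro g hg
    rcases List.mem_append.mp hg with hg | hg
    · exact isBasicFun_of_mem_decChain (by omega) hg
    rcases List.mem_cons.mp hg with rfl | hg
    · exact Or.inr (Or.inr rfl)
    · exact isBasicFun_of_mem_decChain (by omega) hg
  · intro x hx
    rw [compList_append, compList_decChain]
    change incAt i x =
      if 1 < incUpTo d (compList (decChain i (d - i)) x) ∧
          incUpTo d (compList (decChain i (d - i)) x) ≤ 1 + (i - 1) then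
        incUpTo d (compList (decChain i (d - i)) x) - 1
      else incUpTo d (compList (decChain i (d - i)) x)
    rw [compList_decChain]
    unfold incAt incUpTo
    split_ifs <;> omega

end CocPaper
end

section
/- Let d be a positive integer. Every advanced function relative to d is the composition of at most d² basic functions relative to d; that is, for every advanced function f there exist ℓ ≤ d² basic functions g_1,…,g_ℓ with f = g_1 ∘ g_2 ∘ ⋯ ∘ g_ℓ. -/
namespace CocPaper

open SimpleGraph

variable {V : Type} {W : Type}

/-- `f` is a composition of at most `n` basic functions relative to `d`. -/
def IsBasicComp (d n : ℕ) (f : ℕ → ℕ) : Prop :=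
  ∃ L : List (ℕ → ℕ), L.length ≤ n ∧ (∀ g ∈ L, IsBasicFun d g) ∧ compList L = f

theorem compList_append_s8 (L L' : List (ℕ → ℕ)) :
    compList (L ++ L') = compList L ∘ compList L' := by
  induction L with
  | nil => rfl
  | cons g L ih => exact congrArg (g ∘ ·) ih

namespace IsBasicComp

variable {d m n : ℕ} {f g : ℕ → ℕ}

theorem comp (hf : IsBasicComp d m f) (hg : IsBasicComp d n g) :
    IsBasicComp d (m + n) (f ∘ g) := by
  obtain ⟨L, hL, hLb, rfl⟩ := hf
  obtain ⟨L', hL', hLb', rfl⟩ := hg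
  refine ⟨L ++ L', by simpa using Nat.add_le_add hL hL', fun k hk => ?_, compList_append_s8 L L'⟩
  exact (List.mem_append.1 hk).elim (hLb k) (hLb' k)

theorem mono (hf : IsBasicComp d m f) (h : m ≤ n) : IsBasicComp d n f :=
  let ⟨L, hL, hL'⟩ := hf
  ⟨L, hL.trans h, hL'⟩

theorem id (d : ℕ) : IsBasicComp d 0 _root_.id := ⟨[], by simp, by simp, rfl⟩

theorem of_isBasicFun (hf : IsBasicFun d f) : IsBasicComp d 1 f :=
  ⟨[f], by simp, by simpa using hf, rfl⟩

end IsBasicComp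

theorem isBasicComp_decAt {d i : ℕ} (h1 : 1 ≤ i) (hi : i ≤ d) : IsBasicComp d 1 (decAt i) :=
  .of_isBasicFun (.inr (.inl ⟨i, h1, hi, rfl⟩))

theorem isBasicComp_incUpTo (d : ℕ) : IsBasicComp d 1 (incUpTo d) :=
  .of_isBasicFun (.inr (.inr rfl))

/-- Shifting the interval `[a, a + n)` down by one takes `n` basic functions. -/
theorem isBasicComp_shift {d a : ℕ} (n : ℕ) (ha : 1 ≤ a) (h : a + n ≤ d + 1) :
    IsBasicComp d n fun x => if a ≤ x ∧ x < a + n then x - 1 else x := by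
  induction n with
  | zero =>
    convert IsBasicComp.id d using 1
    funext x
    simp only [id]
    split_ifs <;> omega
  | succ n ih =>
    convert ((isBasicComp_decAt (i := a + n) (by omega) (by omega)).comp
      (ih (by omega))).mono (Nat.add_comm 1 n).le using 1
    funext x
    simp only [decAt, Function.comp_apply]
    split_ifs <;> omega

theorem isBasicComp_decIJ {d i : ℕ} (n : ℕ) (h : i + n ≤ d) :
    IsBasicComp d n (decIJ i (i + n)) := by
  induction n with
  | zero =>
    convert IsBasicComp.id d using 1
    funext x
    simp only [decIJ, id]
    split_ifs <;> omega
  | succ n ih =>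
    convert (ih (by omega)).comp
      (isBasicComp_decAt (i := i + (n + 1)) (by omega) (by omega)) using 1
    funext x
    simp only [decAt, decIJ, Function.comp_apply]
    split_ifs <;> omega

/-- Merge `i + 1` into `i` by shifting `[i + 1, d]` down, apply `inc`, and shift `[2, i]`
back down. -/
theorem isBasicComp_incAt {d i : ℕ} (h1 : 1 ≤ i) (hi : i ≤ d) : IsBasicComp d d (incAt i) := by
  convert ((isBasicComp_shift (d := d) (a := 2) (i - 1) (by omega) (by omega)).comp
    ((isBasicComp_incUpTo d).comp
      (isBasicComp_shift (a := i + 1) (d - i) (by omega) (by omega)))).mono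
    (show _ ≤ d by omega) using 1
  funext x
  simp only [incAt, incUpTo, Function.comp_apply]
  split_ifs <;> omega

theorem isBasicComp_incIJ {d i : ℕ} (n : ℕ) (h1 : 1 ≤ i) (h : i + n ≤ d + 1) :
    IsBasicComp d (n * d) (incIJ i (i + n)) := by
  induction n with
  | zero =>
    convert (IsBasicComp.id d).mono (Nat.zero_le _) using 1
    funext x
    simp only [incIJ, id]
    split_ifs <;> omega
  | succ n ih =>
    convert ((isBasicComp_incAt (i := i + n) (by omega) (by omega)).comp
      (ih (by omega))).mono (show _ ≤ (n + 1) * d by rw [Nat.succ_mul, Nat.add_comm]) using 1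
    funext x
    simp only [incAt, incIJ, Function.comp_apply]
    split_ifs <;> omega

/-- Let `d ≥ 1`. Every advanced function relative to `d` is the
composition of at most `d²` basic functions relative to `d`
(as functions on `{0,…,d+1}`). -/
theorem stmt8 (d : ℕ) (hd : 1 ≤ d) (f : ℕ → ℕ) (hf : IsAdvancedFun d f) :
    ∃ L : List (ℕ → ℕ), L.length ≤ d ^ 2 ∧ (∀ g ∈ L, IsBasicFun d g) ∧
      ∀ x ≤ d + 1, f x = compList L x := by
  have hsq : d ≤ d ^ 2 := Nat.le_self_pow two_ne_zero d
  suffices h : IsBasicComp d (d ^ 2) f by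
    obtain ⟨L, hL, hLb, rfl⟩ := h
    exact ⟨L, hL, hLb, fun _ _ => rfl⟩
  rcases hf with ⟨i, h1, hi, rfl⟩ | ⟨i, j, h1, hij, hj, rfl⟩ | ⟨i, j, hij, hj, rfl⟩
  · exact (isBasicComp_incAt h1 hi).mono hsq
  · obtain ⟨n, rfl⟩ := Nat.exists_eq_add_of_le hij.le
    refine (isBasicComp_incIJ n h1 hj).mono ?_
    rw [sq]
    exact Nat.mul_le_mul_right d (by omega)
  · obtain ⟨n, rfl⟩ := Nat.exists_eq_add_of_le hij.le
    exact (isBasicComp_decIJ n hj).mono (by omega)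

end CocPaper
end

section
/- Let d be a positive integer and f : {0,…,d+1} → {0,…,d+1} a non-decreasing function with f ≠ id, f(x) ≥ x for all x ∈ {0,…,d+1}, f(0) = 0, and f(d+1) = d+1. Then there exist ℓ ≤ d+2 − fix(f) advanced functions g_1,…,g_ℓ relative to d such that f = g_1 ∘ g_2 ∘ ⋯ ∘ g_ℓ, where fix(f) denotes the number of fixed points of f. -/
namespace CocPaper

open SimpleGraph

variable {V : Type} {W : Type}

/-- Composing the functions `inc_{x, f x}` over the non-fixed points `x ∈ [k, k + n)` of a
non-decreasing inflationary `f`, larger `x` being applied first, moves exactly the points of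
`[k, k + n)` to their images under `f`. -/
theorem compList_incIJ_range' (f : ℕ → ℕ) (n k : ℕ)
    (hmono : ∀ x y : ℕ, x ≤ y → y < k + n → f x ≤ f y)
    (hge : ∀ x < k + n, x ≤ f x) (x : ℕ) (hx : x < k + n) :
    compList (((List.range' k n).filter fun y => f y ≠ y).map fun y => incIJ y (f y)) x =
      if k ≤ x then f x else x := by
  induction n generalizing k with
  | zero => simp [compList]; omega
  | succ n ih =>
    have ih' := ih (k + 1) (fun a b hab hb => hmono a b hab (by omega))
      (fun a ha => hge a (by omega)) (by omega)
    have hk := hge k (by omega)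
    rw [List.range'_succ, List.filter_cons]
    by_cases hfix : f k = k
    · simp only [hfix, ne_eq, not_true_eq_false, decide_false, Bool.false_eq_true, if_false]
      refine ih'.trans ?_
      rcases lt_trichotomy x k with h | rfl | h
      · rw [if_neg (by omega), if_neg (by omega)]
      · rw [if_neg (by omega), if_pos le_rfl, hfix]
      · rw [if_pos (by omega), if_pos (by omega)]
    · simp only [ne_eq, hfix, not_false_eq_true, decide_true, if_true, List.map_cons]
      change incIJ k (f k) (compList _ x) = _
      refine (congrArg (incIJ k (f k)) ih').trans ?_
      rcases lt_trichotomy x k with h | rfl | h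
      · rw [if_neg (by omega), if_neg (by omega), incIJ, if_neg (by omega)]
      · rw [if_neg (by omega), if_pos le_rfl, incIJ, if_pos ⟨le_rfl, hk⟩]
      · have hkx := hmono k x h.le hx
        rw [if_pos (by omega), if_pos (by omega), incIJ]
        split_ifs <;> omega

/-- The number of non-fixed points of `f` on `{0, …, d+1}` is `d + 2 - fix(f)`. -/
theorem length_filter_ne_eq_sub_fixCount (d : ℕ) (f : ℕ → ℕ) :
    ((List.range' 0 (d + 2)).filter fun y => f y ≠ y).length = d + 2 - fixCount d f := by
  have hcard : ((List.range' 0 (d + 2)).filter fun y => f y ≠ y).length =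
      ((Finset.range (d + 2)).filter fun y => ¬ f y = y).card := by
    rw [← List.range_eq_range']
    rfl
  have hsum := Finset.card_filter_add_card_filter_not (s := Finset.range (d + 2))
    (fun y => f y = y)
  rw [Finset.card_range] at hsum
  rw [hcard, fixCount]
  omega

/-- Let `d ≥ 1` and `f : {0,…,d+1} → {0,…,d+1}` non-decreasing with
`f ≠ id`, `f x ≥ x` on the domain, `f 0 = 0`, `f (d+1) = d+1`. Then there are
`ℓ ≤ d + 2 − fix(f)` advanced functions `g₁,…,g_ℓ` relative to `d` with
`f = g₁ ∘ ⋯ ∘ g_ℓ` (as functions on `{0,…,d+1}`). -/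
theorem stmt9 (d : ℕ) (hd : 1 ≤ d) (f : ℕ → ℕ)
    (hdom : ∀ x ≤ d + 1, f x ≤ d + 1)
    (hmono : ∀ x y : ℕ, x ≤ y → y ≤ d + 1 → f x ≤ f y)
    (hne : ∃ x ≤ d + 1, f x ≠ x)
    (hge : ∀ x ≤ d + 1, x ≤ f x)
    (h0 : f 0 = 0) (htop : f (d + 1) = d + 1) :
    ∃ L : List (ℕ → ℕ), L.length ≤ d + 2 - fixCount d f ∧
      (∀ g ∈ L, IsAdvancedFun d g) ∧ ∀ x ≤ d + 1, f x = compList L x := by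
  refine ⟨((List.range' 0 (d + 2)).filter fun y => f y ≠ y).map fun y => incIJ y (f y),
    ?_, ?_, fun x hx => ?_⟩
  · rw [List.length_map, length_filter_ne_eq_sub_fixCount]
  · simp only [List.mem_map, List.mem_filter, List.mem_range'_1, decide_eq_true_eq]
    rintro g ⟨y, ⟨⟨-, hy⟩, hfy⟩, rfl⟩
    have hy' : y ≤ d + 1 := by omega
    have hlt := lt_of_le_of_ne (hge y hy') (Ne.symm hfy)
    have hpos : y ≠ 0 := by
      rintro rfl
      exact hfy h0
    exact Or.inr (Or.inl ⟨y, f y, by omega, hlt, hdom y hy', rfl⟩)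
  · have h := compList_incIJ_range' f (d + 2) 0 (fun a b hab hb => hmono a b hab (by omega))
      (fun a ha => hge a (by omega)) x (by omega)
    rw [h, if_pos (Nat.zero_le x)]

end CocPaper
end

section
/- Let d be a positive integer and f : {0,…,d+1} → {0,…,d+1} a non-decreasing function with f ≠ id, f(x) ≤ x for all x ∈ {0,…,d+1}, f(0) = 0, and f(d+1) = d+1. Then there exist ℓ ≤ d+2 − fix(f) advanced functions g_1,…,g_ℓ relative to d such that f = g_1 ∘ g_2 ∘ ⋯ ∘ g_ℓ, where fix(f) denotes the number of fixed points of f. -/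
namespace CocPaper

open SimpleGraph

variable {V : Type} {W : Type}

/-- A non-decreasing function below the identity is built up from left to right: the function
agreeing with `f` below `n` and with the identity from `n` on is a composition of decrements,
one for each non-fixed point of `f` below `n`. -/
theorem exists_compList_eq_below (d : ℕ) (f : ℕ → ℕ)
    (hmono : ∀ x y : ℕ, x ≤ y → y ≤ d + 1 → f x ≤ f y)
    (hle : ∀ x ≤ d + 1, f x ≤ x) (htop : f (d + 1) = d + 1) (n : ℕ) (hn : n ≤ d + 2) :
    ∃ L : List (ℕ → ℕ), L.length + ((Finset.range n).filter fun x => f x = x).card = n ∧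
      (∀ g ∈ L, IsAdvancedFun d g) ∧ ∀ x, compList L x = if x < n then f x else x := by
  induction n with
  | zero => exact ⟨[], by simp, by simp, fun x => by simp [compList]⟩
  | succ n ih =>
    obtain ⟨L, hlen, hadv, hcomp⟩ := ih (by omega)
    by_cases hfix : f n = n
    · refine ⟨L, ?_, hadv, fun x => ?_⟩
      · rw [Finset.range_add_one, Finset.filter_insert, if_pos hfix,
          Finset.card_insert_of_notMem (by simp)]
        omega
      · rw [hcomp]
        grind
    · have hlt : f n < n := lt_of_le_of_ne (hle n (by omega)) hfix
      have hnd : n ≤ d := by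
        by_contra! h
        exact hfix (by rwa [show n = d + 1 by omega])
      refine ⟨decIJ (f n) n :: L, ?_, ?_, fun x => ?_⟩
      · rw [Finset.range_add_one, Finset.filter_insert, if_neg hfix, List.length_cons]
        omega
      · exact List.forall_mem_cons.2 ⟨Or.inr (Or.inr ⟨f n, n, hlt, hnd, rfl⟩), hadv⟩
      · change decIJ (f n) n (compList L x) = _
        rw [hcomp]
        unfold decIJ
        rcases lt_trichotomy x n with h | rfl | h
        · have := hmono x n h.le (by omega)
          grind
        · grind
        · grind

/-- Let `d ≥ 1` and `f : {0,…,d+1} → {0,…,d+1}` non-decreasing with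
`f ≠ id`, `f x ≤ x` on the domain, `f 0 = 0`, `f (d+1) = d+1`. Then there are
`ℓ ≤ d + 2 − fix(f)` advanced functions `g₁,…,g_ℓ` relative to `d` with
`f = g₁ ∘ ⋯ ∘ g_ℓ` (as functions on `{0,…,d+1}`). -/
theorem stmt10 (d : ℕ) (hd : 1 ≤ d) (f : ℕ → ℕ)
    (hdom : ∀ x ≤ d + 1, f x ≤ d + 1)
    (hmono : ∀ x y : ℕ, x ≤ y → y ≤ d + 1 → f x ≤ f y)
    (hne : ∃ x ≤ d + 1, f x ≠ x)
    (hle : ∀ x ≤ d + 1, f x ≤ x)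
    (h0 : f 0 = 0) (htop : f (d + 1) = d + 1) :
    ∃ L : List (ℕ → ℕ), L.length ≤ d + 2 - fixCount d f ∧
      (∀ g ∈ L, IsAdvancedFun d g) ∧ ∀ x ≤ d + 1, f x = compList L x := by
  obtain ⟨L, hlen, hadv, hcomp⟩ := exists_compList_eq_below d f hmono hle htop (d + 2) le_rfl
  refine ⟨L, ?_, hadv, fun x hx => ?_⟩
  · unfold fixCount
    omega
  · rw [hcomp, if_pos (by omega)]

end CocPaper
end

section
/- Let d be a positive integer and f a basic function relative to d. Then there exists a caterpillar C whose essence relative to d equals f and whose solution-tight packing has size one, its single graph containing all vertices of C. -/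
namespace CocPaper

open SimpleGraph

variable {V : Type} {W : Type}

section Components

variable (G : SimpleGraph W) (S : Set W)

/-- `u` and `w` lie in the same connected component of `G` after deleting `S`. -/
def JoinedOff (u w : W) : Prop :=
  ∃ (hu : u ∈ Set.univ \ S) (hw : w ∈ Set.univ \ S),
    (G.induce (Set.univ \ S)).Reachable ⟨u, hu⟩ ⟨w, hw⟩

variable {G S}

lemma JoinedOff.refl {u : W} (hu : u ∉ S) : JoinedOff G S u u :=
  ⟨⟨trivial, hu⟩, ⟨trivial, hu⟩, Reachable.refl _⟩

lemma JoinedOff.symm {u w : W} (h : JoinedOff G S u w) : JoinedOff G S w u := by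
  obtain ⟨hu, hw, h⟩ := h
  exact ⟨hw, hu, h.symm⟩

lemma JoinedOff.trans {u v w : W} (h : JoinedOff G S u v) (h' : JoinedOff G S v w) :
    JoinedOff G S u w := by
  obtain ⟨hu, _, h⟩ := h
  obtain ⟨_, hw, h'⟩ := h'
  exact ⟨hu, hw, h.trans h'⟩

lemma JoinedOff.of_adj {u w : W} (hu : u ∉ S) (hw : w ∉ S) (h : G.Adj u w) :
    JoinedOff G S u w :=
  ⟨⟨trivial, hu⟩, ⟨trivial, hw⟩, Adj.reachable (by simpa using h)⟩

lemma JoinedOff.mem_of_closed {u w : W} (h : JoinedOff G S u w) {T : Set W} (hu : u ∈ T)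
    (hT : ∀ a ∈ T, ∀ b ∉ S, G.Adj a b → b ∈ T) : w ∈ T := by
  obtain ⟨hu', hw, ⟨q⟩⟩ := h
  have key : ∀ (a b : ↥(Set.univ \ S)) (_ : (G.induce (Set.univ \ S)).Walk a b),
      (a : W) ∈ T → (b : W) ∈ T := by
    intro a b q
    induction q with
    | nil => exact id
    | @cons _ b _ hab _ ih => exact fun ha => ih (hT _ ha _ b.2.2 (by simpa using hab))
  exact key _ _ q hu

lemma compSizeOn_univ_eq {v : W} {T : Set W} (hv : v ∈ T)
    (hT : ∀ a ∈ T, ∀ b ∉ S, G.Adj a b → b ∈ T) (hj : ∀ w ∈ T, JoinedOff G S v w) :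
    compSizeOn G Set.univ S v = T.ncard := by
  unfold compSizeOn
  congr 1
  ext w
  exact ⟨fun h => JoinedOff.mem_of_closed h hv hT, hj w⟩

lemma compSizeOn_univ_of_mem {v : W} (hv : v ∈ S) : compSizeOn G Set.univ S v = 0 := by
  simp [compSizeOn, hv]

lemma isCocSetOn_univ_iff {d : ℕ} :
    IsCocSetOn G Set.univ d S ↔ ∀ v ∉ S, compSizeOn G Set.univ S v ≤ d := by
  have key : ∀ v (hv : v ∉ S), compSizeOn G Set.univ S v =
      ((G.induce (Set.univ \ S)).connectedComponentMk ⟨v, trivial, hv⟩).supp.ncard := by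
    intro v hv
    rw [compSizeOn, ← Set.ncard_image_of_injective _ Subtype.val_injective]
    congr 1
    ext w
    simp only [Set.mem_ofPred_eq, Set.mem_image, ConnectedComponent.mem_supp_iff,
      ConnectedComponent.eq]
    constructor
    · rintro ⟨hv, hw, h⟩
      exact ⟨⟨w, hw⟩, h.symm, rfl⟩
    · rintro ⟨⟨w, hw⟩, h, rfl⟩
      exact ⟨⟨trivial, hv⟩, hw, h.symm⟩
  constructor
  · intro h v hv
    rw [key v hv]
    exact h _
  · intro h c
    induction c using ConnectedComponent.ind with
    | h v => rw [← key v.1 v.2.2]; exact h _ v.2.2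

end Components

/-- The caterpillar on `W` with spine vertices `s 0, s 1, …`, in which `p w` is the spine
position of `w`: consecutive spine vertices are adjacent, and so are `w` and `s (p w)` for
every pendant `w`. -/
def catGraph (s : ℕ → W) (p : W → ℕ) : SimpleGraph W where
  Adj u v :=
    (u = s (p u) ∧ v = s (p v) ∧ (p u + 1 = p v ∨ p v + 1 = p u)) ∨
    (p u = p v ∧ u ≠ v ∧ (u = s (p u) ∨ v = s (p v)))
  symm := ⟨fun u v h => by
    rcases h with ⟨h1, h2, h3⟩ | ⟨h1, h2, h3⟩
    · exact Or.inl ⟨h2, h1, h3.symm⟩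
    · exact Or.inr ⟨h1.symm, h2.symm, h3.symm⟩⟩
  loopless := ⟨fun u h => by
    rcases h with ⟨_, _, h3⟩ | ⟨_, h2, _⟩
    · omega
    · exact h2 rfl⟩

section CatGraph

variable {s : ℕ → W} {p : W → ℕ} {n d : ℕ}

lemma catGraph_adj {u v : W} : (catGraph s p).Adj u v ↔
    (u = s (p u) ∧ v = s (p v) ∧ (p u + 1 = p v ∨ p v + 1 = p u)) ∨
    (p u = p v ∧ u ≠ v ∧ (u = s (p u) ∨ v = s (p v))) := Iff.rfl

lemma catGraph_joinedOff_of_mem_Icc (hs : ∀ i ≤ n, p (s i) = i) {S : Set W} {a b : ℕ}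
    (hb : b ≤ n) (hS : ∀ i, a ≤ i → i ≤ b → s i ∉ S) {u w : W} (hu : u ∉ S) (hw : w ∉ S)
    (hau : a ≤ p u) (hub : p u ≤ b) (haw : a ≤ p w) (hwb : p w ≤ b) :
    JoinedOff (catGraph s p) S u w := by
  have spine : ∀ i, a ≤ i → i ≤ b → JoinedOff (catGraph s p) S (s a) (s i) := by
    intro i hai
    induction i, hai using Nat.le_induction with
    | base => exact fun h => JoinedOff.refl (hS a le_rfl h)
    | succ i hai ih =>
      intro hib
      refine (ih (by omega)).trans (JoinedOff.of_adj (hS _ hai (by omega))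
        (hS _ (by omega) hib) (Or.inl ?_))
      rw [hs i (by omega), hs (i + 1) (by omega)]
      simp
  have toSpine : ∀ v, v ∉ S → a ≤ p v → p v ≤ b → JoinedOff (catGraph s p) S (s a) v := by
    intro v hv h1 h2
    refine (spine _ h1 h2).trans ?_
    by_cases h : v = s (p v)
    · rw [← h]; exact JoinedOff.refl hv
    · refine JoinedOff.of_adj (hS _ h1 h2) hv (Or.inr ?_)
      rw [hs _ (by omega)]
      exact ⟨rfl, fun h' => h h'.symm, Or.inl rfl⟩
  exact (toSpine u hu hau hub).symm.trans (toSpine w hw haw hwb)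

lemma catGraph_connected (hs : ∀ i ≤ n, p (s i) = i) (hp : ∀ w, p w ≤ n) :
    (catGraph s p).Connected := by
  have : Nonempty W := ⟨s 0⟩
  refine ⟨fun u w => ?_⟩
  obtain ⟨hu, hw, h⟩ := catGraph_joinedOff_of_mem_Icc hs (S := ∅) (a := 0) le_rfl (by simp)
    (Set.notMem_empty u) (Set.notMem_empty w) (Nat.zero_le _) (hp u) (Nat.zero_le _) (hp w)
  exact h.map (Embedding.induce _).toHom

lemma catGraph_isTree [Finite W] (hs : ∀ i ≤ n, p (s i) = i) (hp : ∀ w, p w ≤ n) :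
    (catGraph s p).IsTree := by
  classical
  have hconn := catGraph_connected hs hp
  rw [isTree_iff_connected_and_card]
  refine ⟨hconn, le_antisymm ?_ hconn.card_vert_le_card_edgeSet_add_one⟩
  let parent : W → W := fun u => if u = s (p u) then s (p u - 1) else s (p u)
  have hsub : (catGraph s p).edgeSet ⊆ (fun u => s(u, parent u)) '' {s 0}ᶜ := by
    have hspine : ∀ u v, u = s (p u) → v = s (p v) → p u + 1 = p v →
        v ∈ ({s 0}ᶜ : Set W) ∧ parent v = u := by
      intro u v hu hv huv
      refine ⟨fun h => ?_, ?_⟩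
      · have := hs 0 (Nat.zero_le _)
        rw [← show v = s 0 from h] at this
        omega
      · simp only [parent]
        rw [if_pos hv, ← huv, Nat.add_sub_cancel, ← hu]
    have hpend : ∀ u v, u = s (p u) → p u = p v → u ≠ v →
        v ∈ ({s 0}ᶜ : Set W) ∧ parent v = u := by
      intro u v hu huv hne
      have hv : v ≠ s (p v) := fun h => hne (by rw [hu, h, huv])
      refine ⟨fun h => ?_, ?_⟩
      · apply hv
        have := hs 0 (Nat.zero_le _)
        rw [← show v = s 0 from h] at this
        rw [this]; exact h
      · simp only [parent]
        rw [if_neg hv, ← huv, ← hu]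
    intro e
    induction e with
    | h u v =>
      rw [mem_edgeSet, catGraph_adj]
      rintro (⟨hu, hv, huv | huv⟩ | ⟨huv, hne, hu | hv⟩)
      · obtain ⟨h1, h2⟩ := hspine u v hu hv huv
        exact ⟨v, h1, by simp only [h2]; exact Sym2.eq_swap⟩
      · obtain ⟨h1, h2⟩ := hspine v u hv hu huv
        exact ⟨u, h1, by simp only [h2]⟩
      · obtain ⟨h1, h2⟩ := hpend u v hu huv hne
        exact ⟨v, h1, by simp only [h2]; exact Sym2.eq_swap⟩
      · obtain ⟨h1, h2⟩ := hpend v u hv huv.symm hne.symm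
        exact ⟨u, h1, by simp only [h2]⟩
  have h1 := Set.ncard_le_ncard hsub (Set.toFinite _)
  have h2 := Set.ncard_image_le (f := fun u => s(u, parent u)) (Set.toFinite ({s 0}ᶜ : Set W))
  have h3 := Set.ncard_add_ncard_compl ({s 0} : Set W)
  rw [Set.ncard_singleton] at h3
  rw [Nat.card_coe_set_eq]
  omega

lemma catGraph_compSizeOn_of_lt (hs : ∀ i ≤ n, p (s i) = i) {j : ℕ} (hj : j ≤ n) {v : W}
    (hv : p v < j) :
    compSizeOn (catGraph s p) Set.univ {s j} v = {w | p w < j}.ncard := by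
  have hne : ∀ w, p w < j → w ∉ ({s j} : Set W) := by
    rintro w hw rfl
    rw [hs j hj] at hw
    omega
  refine compSizeOn_univ_eq hv ?_ ?_
  · intro a ha b hb hab
    rw [Set.mem_ofPred_eq] at ha ⊢
    rcases hab with ⟨_, h2, h3⟩ | ⟨h1, _⟩
    · have : p b ≠ j := fun h => hb (by rw [h] at h2; exact h2)
      omega
    · omega
  · intro w hw
    rw [Set.mem_ofPred_eq] at hw
    refine catGraph_joinedOff_of_mem_Icc (a := 0) (b := j - 1) hs (by omega) (fun i _ hi => ?_)
      (hne v hv) (hne w hw) (by omega) (by omega) (by omega) (by omega)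
    exact hne _ (by rw [hs i (by omega)]; omega)

lemma catGraph_compSizeOn_of_gt (hs : ∀ i ≤ n, p (s i) = i) (hp : ∀ w, p w ≤ n) {j : ℕ}
    {v : W} (hv : j < p v) :
    compSizeOn (catGraph s p) Set.univ {s j} v = {w | j < p w}.ncard := by
  have hj : j ≤ n := by have := hp v; omega
  have hne : ∀ w, j < p w → w ∉ ({s j} : Set W) := by
    rintro w hw rfl
    rw [hs j hj] at hw
    omega
  refine compSizeOn_univ_eq hv ?_ ?_
  · intro a ha b hb hab
    rw [Set.mem_ofPred_eq] at ha ⊢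
    rcases hab with ⟨_, h2, h3⟩ | ⟨h1, _⟩
    · have : p b ≠ j := fun h => hb (by rw [h] at h2; exact h2)
      omega
    · omega
  · intro w hw
    rw [Set.mem_ofPred_eq] at hw
    refine catGraph_joinedOff_of_mem_Icc (a := j + 1) (b := n) hs le_rfl (fun i _ hi => ?_)
      (hne v hv) (hne w hw) (by omega) (hp v) (by omega) (hp w)
    exact hne _ (by rw [hs i (by omega)]; omega)

lemma catGraph_compSizeOn_of_eq {j : ℕ} {v : W} (hv : p v = j) (hne : v ≠ s j) :
    compSizeOn (catGraph s p) Set.univ {s j} v = 1 := by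
  rw [compSizeOn_univ_eq (T := {v}) rfl, Set.ncard_singleton]
  · rintro a rfl b hb hab
    subst hv
    rcases hab with ⟨h1, _⟩ | ⟨h1, _, h2 | h2⟩
    · exact absurd h1 hne
    · exact absurd h2 hne
    · exact absurd (by rw [h1]; exact h2) hb
  · rintro w rfl
    exact JoinedOff.refl hne

lemma catGraph_isCocSetOn_singleton_spine (hd : 1 ≤ d) (hs : ∀ i ≤ n, p (s i) = i)
    (hp : ∀ w, p w ≤ n) {j : ℕ} (hj : j ≤ n) :
    IsCocSetOn (catGraph s p) Set.univ d {s j} ↔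
      {w | p w < j}.ncard ≤ d ∧ {w | j < p w}.ncard ≤ d := by
  rw [isCocSetOn_univ_iff]
  constructor
  · intro h
    constructor
    · rcases Set.eq_empty_or_nonempty {w | p w < j} with h0 | ⟨v, hv⟩
      · rw [h0]; simp
      · rw [← catGraph_compSizeOn_of_lt hs hj hv]
        refine h v ?_
        rintro rfl
        rw [Set.mem_ofPred_eq, hs j hj] at hv
        omega
    · rcases Set.eq_empty_or_nonempty {w | j < p w} with h0 | ⟨v, hv⟩
      · rw [h0]; simp
      · rw [← catGraph_compSizeOn_of_gt hs hp hv]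
        refine h v ?_
        rintro rfl
        rw [Set.mem_ofPred_eq, hs j hj] at hv
        omega
  · rintro ⟨hL, hR⟩ v hv
    rcases lt_trichotomy (p v) j with h | h | h
    · rwa [catGraph_compSizeOn_of_lt hs hj h]
    · rwa [catGraph_compSizeOn_of_eq h hv]
    · rwa [catGraph_compSizeOn_of_gt hs hp h]

lemma catGraph_compSizeOn_last (hs : ∀ i ≤ n, p (s i) = i) (hp : ∀ w, p w ≤ n) {j : ℕ}
    (hj : j ≤ n) :
    compSizeOn (catGraph s p) Set.univ {s j} (s n) = {w | j < p w}.ncard := by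
  rcases hj.eq_or_lt with rfl | h
  · rw [compSizeOn_univ_of_mem (Set.mem_singleton _)]
    simp [fun w => (hp w).not_gt]
  · exact catGraph_compSizeOn_of_gt hs hp (by rwa [hs n le_rfl])

/-- Deleting vertices off the spine does not disconnect a caterpillar. -/
lemma catGraph_compSizeOn_of_spine_notMem [Finite W] (hs : ∀ i ≤ n, p (s i) = i)
    (hp : ∀ w, p w ≤ n) {S : Set W} (hS : ∀ i ≤ n, s i ∉ S) {v : W} (hv : v ∉ S) :
    compSizeOn (catGraph s p) Set.univ S v = Nat.card W - S.ncard := by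
  rw [compSizeOn_univ_eq (T := Sᶜ) hv, ← Set.ncard_compl]
  · exact fun _ _ b hb _ => hb
  · exact fun w hw => catGraph_joinedOff_of_mem_Icc (a := 0) hs le_rfl (fun i _ hi => hS i hi)
      hv hw (Nat.zero_le _) (hp _) (Nat.zero_le _) (hp _)

lemma catGraph_one_le_ncard_of_isCocSetOn [Finite W] (hs : ∀ i ≤ n, p (s i) = i)
    (hp : ∀ w, p w ≤ n) (hcard : d + 1 ≤ Nat.card W) {S : Set W}
    (hS : IsCocSetOn (catGraph s p) Set.univ d S) : 1 ≤ S.ncard := by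
  by_contra! h
  have h0 : S = ∅ := (Set.ncard_eq_zero (Set.toFinite _)).1 (by omega)
  subst h0
  have := isCocSetOn_univ_iff.1 hS (s n) (Set.notMem_empty _)
  rw [catGraph_compSizeOn_of_spine_notMem hs hp (by simp) (by simp), Set.ncard_empty] at this
  omega

lemma catGraph_cocOptOn_eq_one [Finite W] (hs : ∀ i ≤ n, p (s i) = i) (hp : ∀ w, p w ≤ n)
    (hcard : d + 1 ≤ Nat.card W) {y : W}
    (hy : IsCocSetOn (catGraph s p) Set.univ d {y}) :
    cocOptOn (catGraph s p) Set.univ d = 1 := by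
  refine le_antisymm (Nat.sInf_le ⟨{y}, Set.subset_univ _, hy, Set.ncard_singleton y⟩) ?_
  refine le_csInf ⟨1, {y}, Set.subset_univ _, hy, Set.ncard_singleton y⟩ ?_
  rintro _ ⟨S, _, hS, rfl⟩
  exact catGraph_one_le_ncard_of_isCocSetOn hs hp hcard hS

lemma catGraph_isCocSetOn_singleton_pendant [Finite W] (hs : ∀ i ≤ n, p (s i) = i)
    (hp : ∀ w, p w ≤ n) {y : W} (hy : ∀ i ≤ n, s i ≠ y)
    (h : IsCocSetOn (catGraph s p) Set.univ d {y}) : Nat.card W ≤ d + 1 := by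
  have := isCocSetOn_univ_iff.1 h (s n) (hy n le_rfl)
  rw [catGraph_compSizeOn_of_spine_notMem (S := {y}) hs hp hy (hy n le_rfl),
    Set.ncard_singleton] at this
  omega

lemma catGraph_sInf_compSizeOn [Finite W] (hd : 1 ≤ d) (hs : ∀ i ≤ n, p (s i) = i)
    (hp : ∀ w, p w ≤ n) (hcard : d + 1 ≤ Nat.card W) {j : ℕ} (hj : j ≤ n)
    (hL : {w | p w < j}.ncard ≤ d) (hR : {w | j < p w}.ncard ≤ d)
    (hmin : ∀ i ≤ n, {w | p w < i}.ncard ≤ d → {w | i < p w}.ncard ≤ d →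
      {w | j < p w}.ncard ≤ {w | i < p w}.ncard) :
    sInf {b : ℕ | ∃ Y : Set W, IsMinCocSetOn (catGraph s p) Set.univ d Y ∧
      b = compSizeOn (catGraph s p) Set.univ Y (s n)} = {w | j < p w}.ncard := by
  have hcoc := (catGraph_isCocSetOn_singleton_spine hd hs hp hj).2 ⟨hL, hR⟩
  have hopt := catGraph_cocOptOn_eq_one hs hp hcard hcoc
  have hmem : {w | j < p w}.ncard ∈ {b : ℕ | ∃ Y : Set W,
      IsMinCocSetOn (catGraph s p) Set.univ d Y ∧
      b = compSizeOn (catGraph s p) Set.univ Y (s n)} :=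
    ⟨{s j}, ⟨Set.subset_univ _, hcoc, by rw [hopt, Set.ncard_singleton]⟩,
      (catGraph_compSizeOn_last hs hp hj).symm⟩
  refine le_antisymm (Nat.sInf_le hmem) (le_csInf ⟨_, hmem⟩ ?_)
  rintro _ ⟨Y, ⟨_, hY, hY1⟩, rfl⟩
  rw [hopt, Set.ncard_eq_one] at hY1
  obtain ⟨y, rfl⟩ := hY1
  by_cases hy : ∃ i ≤ n, s i = y
  · obtain ⟨i, hi, rfl⟩ := hy
    rw [catGraph_compSizeOn_last hs hp hi]
    obtain ⟨h1, h2⟩ := (catGraph_isCocSetOn_singleton_spine hd hs hp hi).1 hY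
    exact hmin i hi h1 h2
  · push Not at hy
    rw [catGraph_compSizeOn_of_spine_notMem (S := {y}) hs hp hy (hy n le_rfl),
      Set.ncard_singleton]
    omega

lemma catGraph_cocOptOn_ne_one [Finite W] (hd : 1 ≤ d) (hs : ∀ i ≤ n, p (s i) = i)
    (hp : ∀ w, p w ≤ n) (hcard : d + 2 ≤ Nat.card W)
    (h : ∀ j ≤ n, {w | p w < j}.ncard ≤ d → d < {w | j < p w}.ncard) :
    cocOptOn (catGraph s p) Set.univ d ≠ 1 := by
  intro hopt
  obtain ⟨Y, _, hY, hY1⟩ := Nat.sInf_mem (Nat.nonempty_of_sInf_eq_succ hopt)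
  rw [show sInf _ = 1 from hopt, Set.ncard_eq_one] at hY1
  obtain ⟨y, rfl⟩ := hY1
  by_cases hy : ∃ i ≤ n, s i = y
  · obtain ⟨i, hi, rfl⟩ := hy
    obtain ⟨h1, h2⟩ := (catGraph_isCocSetOn_singleton_spine hd hs hp hi).1 hY
    have := h i hi h1
    omega
  · push Not at hy
    have := catGraph_isCocSetOn_singleton_pendant hs hp hy hY
    omega

lemma catGraph_induce_univ :
    (catGraph s p).induce Set.univ =
      catGraph (fun i => (⟨s i, trivial⟩ : ↥(Set.univ : Set W))) (fun w => p w) := by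
  ext u v
  simp only [comap_adj, Function.Embedding.subtype_apply, catGraph_adj, Subtype.ext_iff, ne_eq]

lemma attachPendants_catGraph (h0 : p (s 0) = 0) (x : ℕ) :
    attachPendants (catGraph s p) (s 0) x =
      catGraph (fun i => Sum.inl (s i)) (Sum.elim p fun _ : Fin x => 0) := by
  have hs0 : ∀ u : W, u = s 0 ↔ p u = 0 ∧ u = s (p u) :=
    fun u => ⟨fun h => by rw [h, h0]; exact ⟨rfl, rfl⟩, fun ⟨h1, h2⟩ => by rw [h1] at h2; exact h2⟩
  ext u v
  rcases u with u | u <;> rcases v with v | v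
  · have h : (attachPendants (catGraph s p) (s 0) x).Adj (Sum.inl u) (Sum.inl v) ↔
        (catGraph s p).Adj u v := by
      simp only [attachPendants, fromRel_adj]
      constructor
      · rintro ⟨_, (⟨_, _, ⟨rfl⟩, ⟨rfl⟩, h⟩ | ⟨_, _, ⟨⟩⟩) | (⟨_, _, ⟨rfl⟩, ⟨rfl⟩, h⟩ | ⟨_, _, ⟨⟩⟩)⟩
        exacts [h, h.symm]
      · exact fun h => ⟨fun h' => h.ne (Sum.inl_injective h'), Or.inl (Or.inl ⟨u, v, rfl, rfl, h⟩)⟩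
    rw [h]
    simp [catGraph_adj]
  · simp [attachPendants, catGraph_adj, hs0]
  · simp [attachPendants, catGraph_adj, hs0, eq_comm]
  · simp [attachPendants, catGraph_adj]

/-- The spined caterpillar `catGraph s p` with spine `s 0, …, s n`. -/
def catGraphCaterpillar [Finite W] (hs : ∀ i ≤ n, p (s i) = i) (hp : ∀ w, p w ≤ n) :
    SubCaterpillar (catGraph s p) where
  verts := Set.univ
  n := n + 1
  npos := Nat.succ_pos n
  spine i := s i
  spineMem _ := trivial
  spineInj i j hij := by
    have h : p (s i) = p (s j) := congrArg p hij
    rw [hs i (by omega), hs j (by omega)] at h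
    exact Fin.ext h
  spineAdj i hi := by
    refine Or.inl ?_
    simp [hs i (by omega), hs (i + 1) (by omega)]
  isTree := by
    rw [catGraph_induce_univ]
    exact catGraph_isTree (n := n) (fun i hi => hs i hi) (fun w => hp w)
  pendant v _ hv := by
    have hv' : ∀ w, p v = p w → v ≠ s (p w) := fun w _ h =>
      hv ⟨⟨p w, Nat.lt_succ_of_le (hp w)⟩, h.symm⟩
    rw [Set.ncard_eq_one]
    refine ⟨s (p v), Set.ext fun w => ⟨?_, ?_⟩⟩
    · rintro ⟨_, ⟨h1, _⟩ | ⟨h1, _, h2 | h2⟩⟩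
      · exact absurd h1 (hv' v rfl)
      · exact absurd h2 (hv' v rfl)
      · rw [h1]; exact h2
    · rintro rfl
      refine ⟨trivial, Or.inr ?_⟩
      rw [hs _ (hp v)]
      exact ⟨rfl, hv' v rfl, Or.inr rfl⟩

lemma catGraphCaterpillar_isSTP [Finite W] (hs : ∀ i ≤ n, p (s i) = i) (hp : ∀ w, p w ≤ n)
    (hcard : d + 1 ≤ Nat.card W) (hn : IsCocSetOn (catGraph s p) Set.univ d {s n}) :
    IsSTP (catGraph s p) d (catGraphCaterpillar hs hp) {Set.univ} := by
  refine ⟨?_, by simp, ?_, ?_, ⟨n + 1, le_rfl, ?_⟩, ?_⟩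
  · intro A hA
    rw [Finset.mem_singleton] at hA
    subst hA
    exact ⟨subset_rfl, by rwa [Set.ncard_univ], (catGraphCaterpillar hs hp).isTree.1⟩
  · exact (catGraph_cocOptOn_eq_one hs hp hcard hn).symm
  · intro A hA v _ _ _ _ _
    rw [Finset.mem_singleton] at hA
    rw [hA]
    trivial
  · intro j
    simpa using Nat.le_of_lt_succ j.2
  · intro A hA j _ hj
    rw [Finset.mem_singleton] at hA
    subst hA
    have h1 := hj ⟨n, Nat.lt_succ_self n⟩ trivial
    have h2 : (j : ℕ) = n := le_antisymm (Nat.le_of_lt_succ j.2) h1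
    change IsCocSetOn _ _ d {s j}
    rwa [h2]

lemma catGraphCaterpillar_essence [Finite W] (hs : ∀ i ≤ n, p (s i) = i) (hp : ∀ w, p w ≤ n)
    (x : ℕ) :
    (catGraphCaterpillar hs hp).essence d x =
      if x ≤ d ∧ cocOptOn (catGraph (fun i => Sum.inl (⟨s i, trivial⟩ : ↥(Set.univ : Set W)))
          (Sum.elim (fun w => p w) fun _ : Fin x => 0)) Set.univ d =
          cocOptOn (catGraph s p) Set.univ d then
        sInf {b : ℕ | ∃ Y : Set (↥(Set.univ : Set W) ⊕ Fin x),
          IsMinCocSetOn (catGraph (fun i => Sum.inl (⟨s i, trivial⟩ : ↥(Set.univ : Set W)))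
            (Sum.elim (fun w => p w) fun _ : Fin x => 0)) Set.univ d Y ∧
          b = compSizeOn (catGraph (fun i => Sum.inl (⟨s i, trivial⟩ : ↥(Set.univ : Set W)))
            (Sum.elim (fun w => p w) fun _ : Fin x => 0)) Set.univ Y (Sum.inl ⟨s n, trivial⟩)}
      else d + 1 := by
  rw [← attachPendants_catGraph (s := fun i => (⟨s i, trivial⟩ : ↥(Set.univ : Set W)))
    (p := fun w => p w) (hs 0 (Nat.zero_le _)), ← catGraph_induce_univ]
  rfl

end CatGraph

lemma ncard_setOf_sum {α β : Type} [Finite α] [Finite β] (P : α ⊕ β → Prop) :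
    {w | P w}.ncard = {a | P (Sum.inl a)}.ncard + {b | P (Sum.inr b)}.ncard := by
  rw [← Set.ncard_image_of_injective {a | P (Sum.inl a)} (Sum.inl_injective (β := β)),
    ← Set.ncard_image_of_injective {b | P (Sum.inr b)} (Sum.inr_injective (α := α)),
    ← Set.ncard_union_eq]
  · congr 1
    ext (a | b) <;> simp
  · rw [Set.disjoint_left]
    rintro _ ⟨a, _, rfl⟩ ⟨b, _, h⟩
    simp at h

lemma ncard_setOf_const {α : Type} [Finite α] (P : Prop) [Decidable P] :
    {_a : α | P}.ncard = if P then Nat.card α else 0 := by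
  split_ifs with h <;> simp [h]

lemma ncard_setOf_fin_lt {n j : ℕ} (hj : j ≤ n) : {i : Fin n | (i : ℕ) < j}.ncard = j := by
  rw [← Set.ncard_image_of_injective _ Fin.val_injective]
  have : Fin.val '' {i : Fin n | (i : ℕ) < j} = Finset.range j := by
    ext a
    simp only [Set.mem_image, Set.mem_ofPred_eq, Finset.coe_range, Set.mem_Iio]
    exact ⟨fun ⟨i, h1, h2⟩ => h2 ▸ h1, fun h => ⟨⟨a, by omega⟩, h, rfl⟩⟩
  rw [this, Set.ncard_coe_finset, Finset.card_range]

lemma ncard_setOf_lt_fin (n j : ℕ) : {i : Fin n | j < (i : ℕ)}.ncard = n - 1 - j := by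
  rw [← Set.ncard_image_of_injective _ Fin.val_injective]
  have : Fin.val '' {i : Fin n | j < (i : ℕ)} = Finset.Ioo j n := by
    ext a
    simp only [Set.mem_image, Set.mem_ofPred_eq, Finset.coe_Ioo, Set.mem_Ioo]
    exact ⟨fun ⟨i, h1, h2⟩ => h2 ▸ ⟨h1, i.2⟩, fun h => ⟨⟨a, h.2⟩, h.1, rfl⟩⟩
  rw [this, Set.ncard_coe_finset, Nat.card_Ioo]
  omega

/-- A function that records, for every number `x ≤ d` of new pendants, an optimal single
spine vertex to delete is the essence of the caterpillar with spine positions `0, …, n` and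
`m` pendants at position `k`. -/
lemma exists_caterpillar_of_spine_cuts {d n m k : ℕ} (hd : 1 ≤ d) (hk : k ≤ n)
    (hcard : d + 1 ≤ n + 1 + m) (hlast : n + (if k < n then m else 0) ≤ d) (f : ℕ → ℕ)
    (hf : ∀ x ≤ d,
      (∃ j ≤ n, (if 0 < j then x else 0) + j + (if k < j then m else 0) ≤ d ∧
        n - j + (if j < k then m else 0) ≤ d ∧ f x = n - j + (if j < k then m else 0) ∧
        ∀ i ≤ n, (if 0 < i then x else 0) + i + (if k < i then m else 0) ≤ d →
          f x ≤ n - i + (if i < k then m else 0)) ∨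
      (f x = d + 1 ∧ d + 2 ≤ n + 1 + m + x ∧
        ∀ i ≤ n, (if 0 < i then x else 0) + i + (if k < i then m else 0) ≤ d →
          d < n - i + (if i < k then m else 0)))
    (hf' : f (d + 1) = d + 1) :
    ∃ (V : Type) (_ : Fintype V) (H : SimpleGraph V) (C : SubCaterpillar H),
      C.verts = Set.univ ∧
      (∃ Q : Finset (Set V), IsSTP H d C Q ∧ Q.card = 1 ∧
        ⋃₀ (↑Q : Set (Set V)) = C.verts) ∧
      ∀ x ≤ d + 1, C.essence d x = f x := by
  let s : ℕ → Fin (n + 1) ⊕ Fin m := fun i => Sum.inl (Fin.ofNat (n + 1) i)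
  let p : Fin (n + 1) ⊕ Fin m → ℕ := Sum.elim (fun i => (i : ℕ)) (fun _ => k)
  have hs : ∀ i ≤ n, p (s i) = i := fun i hi => Nat.mod_eq_of_lt (Nat.lt_succ_of_le hi)
  have hp : ∀ w, p w ≤ n := by
    rintro (i | i)
    · exact Nat.le_of_lt_succ i.2
    · exact hk
  have hL : ∀ j ≤ n, {w | p w < j}.ncard = j + (if k < j then m else 0) := by
    intro j hj
    rw [ncard_setOf_sum]
    change {i : Fin (n + 1) | (i : ℕ) < j}.ncard + {_i : Fin m | k < j}.ncard = _
    rw [ncard_setOf_fin_lt (by omega), ncard_setOf_const, Nat.card_fin]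
  have hR : ∀ j, {w | j < p w}.ncard = n - j + (if j < k then m else 0) := by
    intro j
    rw [ncard_setOf_sum]
    change {i : Fin (n + 1) | j < (i : ℕ)}.ncard + {_i : Fin m | j < k}.ncard = _
    rw [ncard_setOf_lt_fin, ncard_setOf_const, Nat.card_fin, Nat.add_sub_cancel]
  have hcardW : Nat.card (Fin (n + 1) ⊕ Fin m) = n + 1 + m := by simp
  have hcoc : IsCocSetOn (catGraph s p) Set.univ d {s n} := by
    rw [catGraph_isCocSetOn_singleton_spine hd hs hp le_rfl, hL n le_rfl, hR]
    refine ⟨hlast, ?_⟩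
    rw [if_neg (by omega)]
    omega
  refine ⟨Fin (n + 1) ⊕ Fin m, inferInstance, catGraph s p, catGraphCaterpillar hs hp, rfl,
    ⟨{Set.univ}, catGraphCaterpillar_isSTP hs hp (by omega) hcoc, Finset.card_singleton _,
      by rw [Finset.coe_singleton, Set.sUnion_singleton]; rfl⟩, ?_⟩
  intro x hx
  rw [catGraphCaterpillar_essence]
  rcases hx.eq_or_lt with rfl | hx
  · rw [if_neg (by omega), hf']
  replace hx : x ≤ d := by omega
  rw [catGraph_cocOptOn_eq_one hs hp (by omega) hcoc]
  let s' : ℕ → ↥(Set.univ : Set (Fin (n + 1) ⊕ Fin m)) ⊕ Fin x :=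
    fun i => Sum.inl ⟨s i, trivial⟩
  let p' : ↥(Set.univ : Set (Fin (n + 1) ⊕ Fin m)) ⊕ Fin x → ℕ :=
    Sum.elim (fun w => p w) fun _ => 0
  have hs' : ∀ i ≤ n, p' (s' i) = i := hs
  have hp' : ∀ w, p' w ≤ n := by
    rintro (w | w)
    · exact hp w
    · exact Nat.zero_le _
  have huniv : ∀ P : Fin (n + 1) ⊕ Fin m → Prop,
      {w : ↥(Set.univ : Set (Fin (n + 1) ⊕ Fin m)) | P w}.ncard = {w | P w}.ncard := by
    intro P
    rw [← Set.ncard_image_of_injective _ Subtype.val_injective]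
    congr 1
    ext w
    simp
  have hL' : ∀ j ≤ n, {w | p' w < j}.ncard =
      (if 0 < j then x else 0) + j + (if k < j then m else 0) := by
    intro j hj
    rw [ncard_setOf_sum]
    change {w : ↥(Set.univ : Set (Fin (n + 1) ⊕ Fin m)) | p w < j}.ncard +
      {_i : Fin x | 0 < j}.ncard = _
    rw [huniv (fun w => p w < j), hL j hj, ncard_setOf_const, Nat.card_fin]
    omega
  have hR' : ∀ j, {w | j < p' w}.ncard = n - j + (if j < k then m else 0) := by
    intro j
    rw [ncard_setOf_sum]
    change {w : ↥(Set.univ : Set (Fin (n + 1) ⊕ Fin m)) | j < p w}.ncard +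
      {_i : Fin x | j < 0}.ncard = _
    rw [huniv (fun w => j < p w), hR j, ncard_setOf_const, if_neg (Nat.not_lt_zero j),
      Nat.add_zero]
  have hcardW' : Nat.card (↥(Set.univ : Set (Fin (n + 1) ⊕ Fin m)) ⊕ Fin x) = n + 1 + m + x := by
    simp
  have hcard' : d + 1 ≤ Nat.card (↥(Set.univ : Set (Fin (n + 1) ⊕ Fin m)) ⊕ Fin x) := by omega
  rcases hf x hx with ⟨j, hj, h1, h2, h3, h4⟩ | ⟨h1, h2, h3⟩
  · rw [← hL' j hj] at h1
    rw [← hR' j] at h2 h3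
    rw [if_pos ⟨hx, catGraph_cocOptOn_eq_one hs' hp' hcard'
      ((catGraph_isCocSetOn_singleton_spine hd hs' hp' hj).2 ⟨h1, h2⟩)⟩, h3]
    refine catGraph_sInf_compSizeOn hd hs' hp' hcard' hj h1 h2 fun i hi hi1 _ => ?_
    rw [← h3, hR' i]
    exact h4 i hi (by rwa [← hL' i hi])
  · rw [if_neg, h1]
    refine fun h => catGraph_cocOptOn_ne_one hd hs' hp' (hcardW' ▸ h2) (fun j hj hj1 => ?_) h.2
    rw [hR' j]
    exact h3 j hj (by rwa [← hL' j hj])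

/-- Let `d ≥ 1` and `f` a basic function relative to `d`. Then there
is a caterpillar `C` whose essence relative to `d` equals `f` and whose solution-tight
packing has size one, its single graph containing all vertices of `C`. -/
theorem stmt12 (d : ℕ) (hd : 1 ≤ d) (f : ℕ → ℕ) (hf : IsBasicFun d f) :
    ∃ (V : Type) (_ : Fintype V) (H : SimpleGraph V) (C : SubCaterpillar H),
      C.verts = Set.univ ∧
      (∃ Q : Finset (Set V), IsSTP H d C Q ∧ Q.card = 1 ∧
        ⋃₀ (↑Q : Set (Set V)) = C.verts) ∧
      ∀ x ≤ d + 1, C.essence d x = f x := by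
  rcases hf with rfl | ⟨i, hi, hid, rfl⟩ | rfl
  · refine exists_caterpillar_of_spine_cuts (n := d) (m := 0) (k := 0) hd (by omega) (by omega)
      (by simp) id (fun x hx => Or.inl ⟨d - x, ?_⟩) rfl
    simp only [id_eq, ite_self]
    refine ⟨by omega, by split_ifs <;> omega, by omega, by omega, fun i hi h => ?_⟩
    split_ifs at h <;> omega
  · refine exists_caterpillar_of_spine_cuts (n := d - 1) (m := 1) (k := d - i) hd (by omega)
      (by omega) (by split_ifs <;> omega) (decAt i)
      (fun x hx => Or.inl ⟨if x < i then d - 1 - x else d - x, ?_⟩) ?_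
    · simp only [decAt]
      refine ⟨?_, ?_, ?_, ?_, fun j hj h => ?_⟩
      on_goal 5 => revert h
      all_goals split_ifs <;> omega
    · simp only [decAt]
      split_ifs <;> omega
  · refine exists_caterpillar_of_spine_cuts (n := d) (m := 1) (k := d) hd (by omega)
      (by omega) (by simp) (incUpTo d) (fun x hx => ?_) (by simp [incUpTo])
    simp only [incUpTo]
    rcases hx.eq_or_lt with rfl | hx
    · refine Or.inr ⟨by simp [hd], by omega, fun j hj => ?_⟩
      split_ifs <;> omega
    · refine Or.inl ⟨d - x, Nat.sub_le d x, ?_, ?_, ?_, fun j hj h => ?_⟩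
      on_goal 4 => revert h
      all_goals split_ifs <;> omega

end CocPaper
end
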